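/- arXiv:2307.08542 — 3 statements merged into one kernel-verified Lean document; each statement's English description precedes it below -/
import Mathlib

section
/- Let (Ω, 𝓕) be a measurable space and let B denote the set of bounded measurable functions X : Ω → ℝ. Let I : B → ℝ be normalized (I(0) = 0 and I(1) = 1 for the constant functions 0 and 1), monotone (X(ω) ≥ Y(ω) for all ω implies I(X) ≥ I(Y)), and antimonotonically additive. Then there exists a unique finitely additive probability measure P on 𝓕 (that is, a function P from measurable sets to [0,1] with P(∅) = 0, P(Ω) = 1, and P(A ∪ B) = P(A) + P(B) for all disjoint measurable A, B) such that: (a) for every measurable simple function X ∈ B (i.e., X has finite range), I(X) = Σ_{c ∈ range X} c · P(X⁻¹{c}); and (b) for every X ∈ B, I(X) = sup { I(s) : s a measurable simple function with s(ω) ≤ X(ω) for all ω }, so that I is the expectation of X with respect to P. -/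
/-- Two functions `X, Y : Ω → ℝ` are comonotonic if
`(X ω - X ω') * (Y ω - Y ω') ≥ 0` for all `ω, ω'`. -/
def Comonotonic {Ω : Type*} (X Y : Ω → ℝ) : Prop :=
  ∀ ω ω' : Ω, (X ω - X ω') * (Y ω - Y ω') ≥ 0

/-- `X` and `Y` are antimonotonic if `X` and `-Y` are comonotonic. -/
def Antimonotonic {Ω : Type*} (X Y : Ω → ℝ) : Prop :=
  Comonotonic X (-Y)

/-- The set of bounded measurable real-valued functions on `Ω`. -/
def BddMeas (Ω : Type*) [MeasurableSpace Ω] : Set (Ω → ℝ) :=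
  {X | Measurable X ∧ ∃ M : ℝ, ∀ ω, |X ω| ≤ M}

/-- `P` is a finitely additive probability measure representing `I` as an
expectation: `P` takes values in `[0,1]` on measurable sets, is normalized and
finitely additive, `I` of every measurable simple function is its `P`-expectation,
and `I X` is the supremum of `I s` over measurable simple `s ≤ X`. -/
def RepProb {Ω : Type*} [MeasurableSpace Ω] (I : (Ω → ℝ) → ℝ) (P : Set Ω → ℝ) : Prop :=
  (∀ E : Set Ω, MeasurableSet E → 0 ≤ P E ∧ P E ≤ 1) ∧
  P ∅ = 0 ∧
  P Set.univ = 1 ∧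
  (∀ A B : Set Ω, MeasurableSet A → MeasurableSet B → Disjoint A B →
    P (A ∪ B) = P A + P B) ∧
  (∀ X : Ω → ℝ, Measurable X → ∀ hfin : (Set.range X).Finite,
    I X = ∑ c ∈ hfin.toFinset, c * P (X ⁻¹' {c})) ∧
  (∀ X ∈ BddMeas Ω,
    IsLUB {y : ℝ | ∃ s : Ω → ℝ, Measurable s ∧ (Set.range s).Finite ∧
      (∀ ω, s ω ≤ X ω) ∧ y = I s} (I X))

namespace BddMeas

variable {Ω : Type*} [MeasurableSpace Ω] {X Y : Ω → ℝ}

lemma const (c : ℝ) : (fun _ : Ω => c) ∈ BddMeas Ω :=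
  ⟨measurable_const, |c|, fun _ => le_rfl⟩

lemma add (hX : X ∈ BddMeas Ω) (hY : Y ∈ BddMeas Ω) : X + Y ∈ BddMeas Ω := by
  obtain ⟨hXm, M, hM⟩ := hX
  obtain ⟨hYm, N, hN⟩ := hY
  exact ⟨hXm.add hYm, M + N, fun ω => (abs_add_le _ _).trans (add_le_add (hM ω) (hN ω))⟩

lemma smul (t : ℝ) (hX : X ∈ BddMeas Ω) : t • X ∈ BddMeas Ω := by
  obtain ⟨hXm, M, hM⟩ := hX
  refine ⟨hXm.const_smul t, |t| * M, fun ω => ?_⟩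
  simpa [abs_mul] using mul_le_mul_of_nonneg_left (hM ω) (abs_nonneg t)

lemma indicator_one {E : Set Ω} (hE : MeasurableSet E) :
    E.indicator (1 : Ω → ℝ) ∈ BddMeas Ω := by
  refine ⟨measurable_one.indicator hE, 1, fun ω => ?_⟩
  by_cases h : ω ∈ E <;> simp [h]

lemma of_finite_range (hX : Measurable X) (hfin : (Set.range X).Finite) : X ∈ BddMeas Ω := by
  obtain ⟨M, hM⟩ := (hfin.image abs).bddAbove
  exact ⟨hX, M, fun ω => hM ⟨X ω, ⟨ω, rfl⟩, rfl⟩⟩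

lemma sum {ι : Type*} (S : Finset ι) {f : ι → Ω → ℝ} (hf : ∀ i ∈ S, f i ∈ BddMeas Ω) :
    ∑ i ∈ S, f i ∈ BddMeas Ω :=
  Finset.sum_induction f (· ∈ BddMeas Ω) (fun _ _ => add) (const 0) hf

end BddMeas

section Antimonotonic

variable {Ω : Type*}

lemma antimonotonic_const (X : Ω → ℝ) (c : ℝ) : Antimonotonic X (fun _ => c) := by
  intro ω ω'
  simp

lemma antimonotonic_smul_smul (X : Ω → ℝ) {s t : ℝ} (h : s * t ≤ 0) :
    Antimonotonic (s • X) (t • X) := by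
  intro ω ω'
  simp only [Pi.smul_apply, Pi.neg_apply, smul_eq_mul]
  nlinarith [mul_nonneg (neg_nonneg.2 h) (sq_nonneg (X ω - X ω'))]

/-- Nonnegative functions with disjoint supports are antimonotonic. -/
lemma antimonotonic_of_mul_eq_zero {X Y : Ω → ℝ} (hX : 0 ≤ X) (hY : 0 ≤ Y)
    (h : ∀ ω, X ω * Y ω = 0) : Antimonotonic X Y := by
  intro ω ω'
  simp only [Pi.neg_apply]
  nlinarith [h ω, h ω', mul_nonneg (hX ω) (hY ω'), mul_nonneg (hX ω') (hY ω)]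

end Antimonotonic

/-- A monotone additive function on the reals is linear. -/
lemma Monotone.eq_mul_of_map_add {g : ℝ → ℝ} (hg : Monotone g)
    (hadd : ∀ s t, g (s + t) = g s + g t) (t : ℝ) : g t = t * g 1 := by
  let f : ℝ →+ ℝ := AddMonoidHom.mk' g hadd
  have hf : Continuous f :=
    MeasureTheory.Measure.AddMonoidHom.continuous_of_measurable f hg.measurable
  simpa [f] using map_real_smul f hf t 1

/-- A normalized, monotone and antimonotonically additive functional on the bounded measurable
functions. -/
structure IsAmPricing {Ω : Type*} [MeasurableSpace Ω] (I : (Ω → ℝ) → ℝ) : Prop where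
  map_zero : I 0 = 0
  map_one : I 1 = 1
  mono : ∀ X ∈ BddMeas Ω, ∀ Y ∈ BddMeas Ω, (∀ ω, X ω ≥ Y ω) → I X ≥ I Y
  map_add : ∀ X ∈ BddMeas Ω, ∀ Y ∈ BddMeas Ω, Antimonotonic X Y → I (X + Y) = I X + I Y

namespace IsAmPricing

variable {Ω : Type*} [MeasurableSpace Ω] {I : (Ω → ℝ) → ℝ} {X : Ω → ℝ}

lemma map_add_smul (h : IsAmPricing I) (hX : X ∈ BddMeas Ω) (s t : ℝ) :
    I ((s + t) • X) = I (s • X) + I (t • X) := by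
  have key : ∀ a b : ℝ, a * b ≤ 0 → I ((a + b) • X) = I (a • X) + I (b • X) := fun a b hab => by
    rw [add_smul]
    exact h.map_add _ (BddMeas.smul a hX) _ (BddMeas.smul b hX) (antimonotonic_smul_smul X hab)
  have hneg : I (t • X) + I ((-t) • X) = 0 := by
    rw [← key t (-t) (by nlinarith [sq_nonneg t]), add_neg_cancel, zero_smul, h.map_zero]
  rcases le_total (s * t) 0 with hst | hst
  · exact key s t hst
  · have hsub := key (s + t) (-t) (by nlinarith [sq_nonneg t])
    rw [add_neg_cancel_right] at hsub
    linarith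

lemma map_smul_of_nonneg (h : IsAmPricing I) (hX : X ∈ BddMeas Ω) (h0 : 0 ≤ X) (t : ℝ) :
    I (t • X) = t * I X := by
  have hmono : Monotone fun t : ℝ => I (t • X) := fun s t hst =>
    h.mono _ (BddMeas.smul t hX) _ (BddMeas.smul s hX) fun ω => mul_le_mul_of_nonneg_right hst (h0 ω)
  simpa using hmono.eq_mul_of_map_add (h.map_add_smul hX) t

lemma map_const (h : IsAmPricing I) (c : ℝ) : I (fun _ => c) = c := by
  have hc := h.map_smul_of_nonneg (BddMeas.const 1) (fun _ => zero_le_one) c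
  have h1 : I (fun _ => 1) = 1 := h.map_one
  rw [h1, mul_one] at hc
  convert hc using 2
  ext
  simp

lemma map_add_const (h : IsAmPricing I) (hX : X ∈ BddMeas Ω) (c : ℝ) :
    I (X + fun _ => c) = I X + c := by
  rw [h.map_add _ hX _ (BddMeas.const c) (antimonotonic_const X c), h.map_const]

/-- Additivity on nonnegative combinations of indicators of disjoint sets. -/
lemma map_sum_indicator (h : IsAmPricing I) {ι : Type*} (S : Finset ι) {a : ι → ℝ}
    (ha : ∀ i ∈ S, 0 ≤ a i) {A : ι → Set Ω} (hA : ∀ i, MeasurableSet (A i))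
    (hd : Pairwise fun i j => Disjoint (A i) (A j)) :
    I (∑ i ∈ S, a i • (A i).indicator 1) = ∑ i ∈ S, a i * I ((A i).indicator 1) := by
  classical
  have hmem : ∀ i, a i • (A i).indicator (1 : Ω → ℝ) ∈ BddMeas Ω := fun i =>
    BddMeas.smul (a i) (BddMeas.indicator_one (hA i))
  have hpos : ∀ i, 0 ≤ (A i).indicator (1 : Ω → ℝ) := fun i =>
    Set.indicator_nonneg fun _ _ => zero_le_one
  induction S using Finset.induction_on with
  | empty => simpa using h.map_zero
  | insert i S hi ih =>
    have haS : ∀ j ∈ S, 0 ≤ a j := fun j hj => ha j (Finset.mem_insert_of_mem hj)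
    have hai : 0 ≤ a i := ha i (Finset.mem_insert_self i S)
    rw [Finset.sum_insert hi, Finset.sum_insert hi, ← ih haS,
      ← h.map_smul_of_nonneg (BddMeas.indicator_one (hA i)) (hpos i)]
    refine h.map_add _ (hmem i) _ (BddMeas.sum S fun j _ => hmem j)
      (antimonotonic_of_mul_eq_zero (smul_nonneg hai (hpos i))
        (Finset.sum_nonneg fun j hj => smul_nonneg (haS j hj) (hpos j)) fun ω => ?_)
    rw [Finset.sum_apply, Finset.mul_sum]
    refine Finset.sum_eq_zero fun j hj => ?_
    have hij : i ≠ j := fun e => hi (e ▸ hj)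
    by_cases hω : ω ∈ A i
    · simp [Set.disjoint_left.1 (hd hij) hω]
    · simp [hω]

lemma map_indicator_union (h : IsAmPricing I) {A B : Set Ω} (hA : MeasurableSet A)
    (hB : MeasurableSet B) (hd : Disjoint A B) :
    I ((A ∪ B).indicator 1) = I (A.indicator 1) + I (B.indicator 1) := by
  rw [Set.indicator_union_of_disjoint hd]
  refine h.map_add _ (BddMeas.indicator_one hA) _ (BddMeas.indicator_one hB)
    (antimonotonic_of_mul_eq_zero (Set.indicator_nonneg fun _ _ => zero_le_one)
      (Set.indicator_nonneg fun _ _ => zero_le_one) fun ω => ?_)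
  by_cases hω : ω ∈ A
  · simp [Set.disjoint_left.1 hd hω]
  · simp [hω]

lemma map_simple (h : IsAmPricing I) (hX : Measurable X) (hfin : (Set.range X).Finite) :
    I X = ∑ c ∈ hfin.toFinset, c * I ((X ⁻¹' {c}).indicator 1) := by
  have hB := BddMeas.of_finite_range hX hfin
  obtain ⟨M, hM⟩ := hB.2
  have hA : ∀ c, MeasurableSet (X ⁻¹' {c}) := fun c => hX (measurableSet_singleton c)
  have hd : Pairwise fun c d => Disjoint (X ⁻¹' {c}) (X ⁻¹' {d}) := fun c d hcd =>
    Disjoint.preimage X (Set.disjoint_singleton.2 hcd)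
  have hdecomp : ∀ (a : ℝ → ℝ),
      ∑ c ∈ hfin.toFinset, a c • (X ⁻¹' {c}).indicator (1 : Ω → ℝ) = fun ω => a (X ω) := by
    intro a
    ext ω
    rw [Finset.sum_apply, Finset.sum_eq_single (X ω)]
    · simp
    · intro c _ hc
      simp [Ne.symm hc]
    · intro hω
      exact absurd (hfin.mem_toFinset.2 ⟨ω, rfl⟩) hω
  have hshift := h.map_sum_indicator hfin.toFinset (a := fun c => c + M) (fun c hc => by
    obtain ⟨ω, rfl⟩ := hfin.mem_toFinset.1 hc
    linarith [neg_le_of_abs_le (hM ω)]) hA hd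
  have htotal := h.map_sum_indicator hfin.toFinset (a := fun _ => 1)
    (fun _ _ => zero_le_one) hA hd
  rw [hdecomp] at hshift htotal
  rw [h.map_const] at htotal
  have hXM : I (fun ω => X ω + M) = I X + M := h.map_add_const hB M
  rw [hXM] at hshift
  simp only [add_mul, one_mul, Finset.sum_add_distrib, ← Finset.mul_sum] at hshift htotal
  rw [← htotal] at hshift
  linarith

end IsAmPricing

/-- Rounding a bounded measurable function down to a multiple of `ε` gives a simple function. -/
lemma BddMeas.exists_simple_le {Ω : Type*} [MeasurableSpace Ω] {X : Ω → ℝ} (hX : X ∈ BddMeas Ω)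
    {ε : ℝ} (hε : 0 < ε) :
    ∃ s : Ω → ℝ, Measurable s ∧ (Set.range s).Finite ∧ (∀ ω, s ω ≤ X ω) ∧
      ∀ ω, X ω ≤ s ω + ε := by
  obtain ⟨hXm, M, hM⟩ := hX
  refine ⟨fun ω => ε * (⌊X ω / ε⌋ : ℤ), ?_, ?_, fun ω => ?_, fun ω => ?_⟩
  · exact (measurable_from_top.comp (hXm.div_const ε).floor).const_mul ε
  · refine ((Set.finite_Icc ⌊-M / ε⌋ ⌊M / ε⌋).image fun n : ℤ => ε * (n : ℝ)).subset ?_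
    rintro _ ⟨ω, rfl⟩
    have := abs_le.1 (hM ω)
    refine ⟨⌊X ω / ε⌋, ⟨Int.floor_le_floor ?_, Int.floor_le_floor ?_⟩, rfl⟩
    · exact div_le_div_of_nonneg_right this.1 hε.le
    · exact div_le_div_of_nonneg_right this.2 hε.le
  · have := (le_div_iff₀ hε).1 (Int.floor_le (X ω / ε))
    linarith
  · have := (div_lt_iff₀ hε).1 (Int.lt_floor_add_one (X ω / ε))
    linarith

lemma IsAmPricing.isLUB_simple {Ω : Type*} [MeasurableSpace Ω] {I : (Ω → ℝ) → ℝ} {X : Ω → ℝ}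
    (h : IsAmPricing I) (hX : X ∈ BddMeas Ω) :
    IsLUB {y : ℝ | ∃ s : Ω → ℝ, Measurable s ∧ (Set.range s).Finite ∧
      (∀ ω, s ω ≤ X ω) ∧ y = I s} (I X) := by
  refine ⟨?_, fun b hb => le_of_forall_pos_le_add fun ε hε => ?_⟩
  · rintro _ ⟨s, hs, hfin, hle, rfl⟩
    exact h.mono _ hX _ (BddMeas.of_finite_range hs hfin) hle
  · obtain ⟨s, hs, hfin, hle, hge⟩ := BddMeas.exists_simple_le hX hε
    have hsB := BddMeas.of_finite_range hs hfin
    have h1 := h.mono (s + fun _ => ε) (BddMeas.add hsB (BddMeas.const ε)) _ hX hge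
    rw [h.map_add_const hsB] at h1
    have h2 : I s ≤ b := hb ⟨s, hs, hfin, hle, rfl⟩
    linarith

lemma IsAmPricing.repProb {Ω : Type*} [MeasurableSpace Ω] {I : (Ω → ℝ) → ℝ}
    (h : IsAmPricing I) : RepProb I fun E => I (E.indicator 1) := by
  refine ⟨fun E hE => ⟨?_, ?_⟩, ?_, ?_, fun A B => h.map_indicator_union,
    fun X => h.map_simple, fun X => h.isLUB_simple⟩
  · have := h.mono _ (BddMeas.indicator_one hE) _ (BddMeas.const 0)
      (Set.indicator_nonneg fun _ _ => zero_le_one)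
    rwa [h.map_const] at this
  · have := h.mono _ (BddMeas.const 1) _ (BddMeas.indicator_one hE)
      fun ω => Set.indicator_le_self' (fun _ _ => zero_le_one) ω
    rwa [h.map_const] at this
  · simpa using h.map_const 0
  · simpa using h.map_one

/-- A representing probability is determined by the prices of indicators. -/
lemma RepProb.apply_eq {Ω : Type*} [MeasurableSpace Ω] {I : (Ω → ℝ) → ℝ} {Q : Set Ω → ℝ}
    (hQ : RepProb I Q) {E : Set Ω} (hE : MeasurableSet E) : Q E = I (E.indicator 1) := by
  obtain ⟨-, hempty, -, -, hsimple, -⟩ := hQ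
  have hsub : Set.range (E.indicator (1 : Ω → ℝ)) ⊆ ({0, 1} : Finset ℝ) := by
    rintro _ ⟨ω, rfl⟩
    by_cases hω : ω ∈ E <;> simp [hω]
  have hfin := (Finset.finite_toSet _).subset hsub
  have hone : E.indicator (1 : Ω → ℝ) ⁻¹' {1} = E := by
    ext ω
    by_cases hω : ω ∈ E <;> simp [hω]
  rw [hsimple _ (measurable_one.indicator hE) hfin,
    Finset.sum_subset (s₂ := {0, 1}) (fun c hc => hsub (hfin.mem_toFinset.1 hc))]
  · simp [hone]
  · intro c _ hc
    rw [Set.preimage_singleton_eq_empty.2 fun hmem => hc (hfin.mem_toFinset.2 hmem), hempty,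
      mul_zero]


/-- Antimonotonic fundamental theorem of asset pricing: a normalized, monotone,
antimonotonically additive functional on the bounded measurable functions is the
expectation with respect to a unique finitely additive probability measure. -/
theorem am_no_arbitrage {Ω : Type*} [MeasurableSpace Ω]
    (I : (Ω → ℝ) → ℝ)
    (hnorm0 : I 0 = 0) (hnorm1 : I 1 = 1)
    (hmono : ∀ X ∈ BddMeas Ω, ∀ Y ∈ BddMeas Ω, (∀ ω, X ω ≥ Y ω) → I X ≥ I Y)
    (hadd : ∀ X ∈ BddMeas Ω, ∀ Y ∈ BddMeas Ω, Antimonotonic X Y →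
      I (X + Y) = I X + I Y) :
    ∃ P : Set Ω → ℝ, RepProb I P ∧
      ∀ Q : Set Ω → ℝ, RepProb I Q → ∀ E : Set Ω, MeasurableSet E → Q E = P E := by
  have h : IsAmPricing I := ⟨hnorm0, hnorm1, hmono, hadd⟩
  exact ⟨_, h.repProb, fun Q hQ E hE => hQ.apply_eq hE⟩
end

section
/- Let Ω be a finite nonempty set and I : (Ω → ℝ) → ℝ. Then the following are equivalent: (1) I is normalized (I(0) = 0 and I(1) = 1 for constant functions), monotone (X(ω) ≥ Y(ω) for all ω implies I(X) ≥ I(Y)), symmetric (I(X ∘ σ) = I(X) for every permutation σ of Ω and every X), and antimonotonically additive; (2) I is the expectation with respect to the uniform probability on Ω, i.e., I(X) = (1/|Ω|) · Σ_{ω ∈ Ω} X(ω) for all X. -/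
theorem eq_id_of_monotone_of_additive {f : ℝ → ℝ} (hmono : Monotone f)
    (hadd : ∀ x y, f (x + y) = f x + f y) (h1 : f 1 = 1) (x : ℝ) : f x = x := by
  have hnat (n : ℕ) (y : ℝ) : f (n * y) = n * f y := by
    simpa using map_nsmul (AddMonoidHom.mk' f hadd) n y
  have hint (m : ℤ) : f m = m := by
    simpa [h1] using map_zsmul (AddMonoidHom.mk' f hadd) m 1
  have hbound (n : ℕ) : n * |f x - x| ≤ 1 := by
    have hlow := hmono (Int.floor_le (n * x))
    have hup := hmono (Int.lt_floor_add_one (n * x)).le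
    rw [hint, hnat] at hlow
    rw [hadd, hint, h1, hnat] at hup
    rw [← Nat.abs_cast n, ← abs_mul, abs_le]
    constructor <;> linarith [Int.floor_le (n * x), Int.lt_floor_add_one (n * x)]
  by_contra hne
  obtain ⟨n, hn⟩ := exists_nat_gt (1 / |f x - x|)
  rw [div_lt_iff₀ (abs_pos.2 (sub_ne_zero.2 hne))] at hn
  exact absurd (hbound n) (not_le.2 hn)

theorem antimonotonic_const_s6 {Ω : Type*} (X : Ω → ℝ) (c : ℝ) :
    Antimonotonic X (Function.const Ω c) := by
  intro ω ω'
  simp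

/-- Nonnegative functions with disjoint supports are antimonotonic. -/
theorem antimonotonic_of_nonneg_of_mul_eq_zero {Ω : Type*} {X Y : Ω → ℝ}
    (hX : 0 ≤ X) (hY : 0 ≤ Y) (h : X * Y = 0) : Antimonotonic X Y := by
  intro ω ω'
  have h₁ : X ω * Y ω = 0 := congrFun h ω
  have h₂ : X ω' * Y ω' = 0 := congrFun h ω'
  simp only [Pi.neg_apply]
  linarith [mul_nonneg (hX ω) (hY ω'), mul_nonneg (hX ω') (hY ω)]

theorem map_sum_single_of_nonneg {Ω : Type*} [DecidableEq Ω] {I : (Ω → ℝ) → ℝ}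
    (h0 : I 0 = 0) (hadd : ∀ X Y : Ω → ℝ, Antimonotonic X Y → I (X + Y) = I X + I Y)
    {X : Ω → ℝ} (hX : 0 ≤ X) (s : Finset Ω) :
    I (∑ i ∈ s, Pi.single i (X i)) = ∑ i ∈ s, I (Pi.single i (X i)) := by
  induction s using Finset.induction_on with
  | empty => simpa using h0
  | insert a s ha ih =>
    rw [Finset.sum_insert ha, Finset.sum_insert ha, hadd _ _ ?_, ih]
    refine antimonotonic_of_nonneg_of_mul_eq_zero (Pi.single_nonneg.2 (hX a))
      (Finset.sum_nonneg fun i _ => Pi.single_nonneg.2 (hX i)) ?_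
    rw [Finset.mul_sum]
    refine Finset.sum_eq_zero fun i hi => ?_
    have hai : a ≠ i := fun h => ha (h ▸ hi)
    ext ω
    by_cases hω : ω = a
    · subst hω
      simp [hai]
    · simp [hω]

/-- On a finite nonempty state space, a functional is normalized, monotone,
symmetric (law-based for the uniform probability), and antimonotonically
additive if and only if it is the expectation with respect to the uniform
probability. -/
theorem am_uniform_expectation {Ω : Type*} [Fintype Ω] [Nonempty Ω]
    (I : (Ω → ℝ) → ℝ) :
    (I 0 = 0 ∧ I 1 = 1 ∧
     (∀ X Y : Ω → ℝ, (∀ ω, X ω ≥ Y ω) → I X ≥ I Y) ∧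
     (∀ (σ : Equiv.Perm Ω) (X : Ω → ℝ), I (X ∘ σ) = I X) ∧
     (∀ X Y : Ω → ℝ, Antimonotonic X Y → I (X + Y) = I X + I Y)) ↔
    (∀ X : Ω → ℝ, I X = (1 / (Fintype.card Ω : ℝ)) * ∑ ω, X ω) := by
  classical
  have hcard : (Fintype.card Ω : ℝ) ≠ 0 := Nat.cast_ne_zero.2 Fintype.card_ne_zero
  constructor
  · rintro ⟨h0, h1, hmono, hsymm, hadd⟩
    have hconst : ∀ c : ℝ, I (Function.const Ω c) = c :=
      eq_id_of_monotone_of_additive (fun c d hcd => hmono _ _ fun _ => hcd)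
        (fun c d => hadd _ _ (antimonotonic_const_s6 _ d)) h1
    have hsum {X : Ω → ℝ} (hX : 0 ≤ X) : I X = ∑ i, I (Pi.single i (X i)) := by
      rw [← map_sum_single_of_nonneg h0 hadd hX, Finset.univ_sum_single]
    have hswap (i j : Ω) (c : ℝ) : I (Pi.single i c) = I (Pi.single j c) := by
      rw [← hsymm (Equiv.swap i j) (Pi.single i c)]
      congr 1
      ext ω
      simp [Pi.single_apply, Equiv.swap_apply_eq_iff]
    have hsingle (i : Ω) {c : ℝ} (hc : 0 ≤ c) :
        I (Pi.single i c) = 1 / (Fintype.card Ω : ℝ) * c := by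
      have h := hsum (X := Function.const Ω c) fun _ => hc
      simp only [hconst, Function.const_apply, hswap _ i, Finset.sum_const,
        Finset.card_univ, nsmul_eq_mul] at h
      field_simp
      linarith
    have hnonneg {X : Ω → ℝ} (hX : 0 ≤ X) :
        I X = 1 / (Fintype.card Ω : ℝ) * ∑ ω, X ω := by
      rw [hsum hX, Finset.mul_sum]
      exact Finset.sum_congr rfl fun i _ => hsingle i (hX i)
    intro X
    obtain ⟨c, hc⟩ := (Set.finite_range X).bddBelow
    have hpos : 0 ≤ X + Function.const Ω (-c) := fun ω => by
      simpa using hc (Set.mem_range_self ω)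
    have h := hnonneg hpos
    rw [hadd _ _ (antimonotonic_const_s6 _ _), hconst] at h
    simp only [Pi.add_apply, Function.const_apply, Finset.sum_add_distrib, Finset.sum_const,
      Finset.card_univ, nsmul_eq_mul] at h
    field_simp at h ⊢
    linarith
  · intro h
    refine ⟨by simp [h], by simp [h], fun X Y hXY => ?_, fun σ X => ?_, fun X Y _ => ?_⟩
    · rw [h, h]
      exact mul_le_mul_of_nonneg_left (Finset.sum_le_sum fun ω _ => hXY ω) (by positivity)
    · rw [h, h]
      congr 1
      exact Equiv.sum_comp σ X
    · simp [h, Finset.sum_add_distrib, mul_add]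
end

section
/- Let (Ω, 𝓕) be a measurable space, B the set of bounded measurable functions Ω → ℝ with the supremum metric, and D ⊆ B a convex set that contains a supremum-metric ball around some constant function k. Let I : D → ℝ be continuous with respect to the supremum metric. Then I is antimonotonically affine if and only if I is affine, i.e., I(αX + (1−α)Y) = αI(X) + (1−α)I(Y) for all α ∈ [0,1] and all X, Y ∈ D. -/
theorem BddMeas.const_s8 {Ω : Type*} [MeasurableSpace Ω] (c : ℝ) :
    (fun _ : Ω => c) ∈ BddMeas Ω :=
  ⟨measurable_const, |c|, fun _ => le_rfl⟩

theorem BddMeas.add_mem {Ω : Type*} [MeasurableSpace Ω] {X Y : Ω → ℝ}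
    (hX : X ∈ BddMeas Ω) (hY : Y ∈ BddMeas Ω) : X + Y ∈ BddMeas Ω := by
  obtain ⟨hXm, M, hM⟩ := hX
  obtain ⟨hYm, N, hN⟩ := hY
  exact ⟨hXm.add hYm, M + N, fun ω => (abs_add_le _ _).trans (add_le_add (hM ω) (hN ω))⟩

theorem BddMeas.smul_mem {Ω : Type*} [MeasurableSpace Ω] {X : Ω → ℝ}
    (c : ℝ) (hX : X ∈ BddMeas Ω) : c • X ∈ BddMeas Ω := by
  obtain ⟨hXm, M, hM⟩ := hX
  refine ⟨hXm.const_smul c, |c| * M, fun ω => ?_⟩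
  simpa [abs_mul] using mul_le_mul_of_nonneg_left (hM ω) (abs_nonneg c)

theorem BddMeas.indicator_one_s8 {Ω : Type*} [MeasurableSpace Ω] {A : Set Ω}
    (hA : MeasurableSet A) : A.indicator (1 : Ω → ℝ) ∈ BddMeas Ω := by
  refine ⟨measurable_one.indicator hA, 1, fun ω => ?_⟩
  by_cases h : ω ∈ A <;> simp [h]

theorem antimonotonic_const_right {Ω : Type*} (X : Ω → ℝ) (c : ℝ) :
    Antimonotonic X (fun _ => c) := by
  intro ω ω'
  simp

theorem antimonotonic_of_disjoint_support {Ω : Type*} {X Y : Ω → ℝ}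
    (hX : ∀ ω, 0 ≤ X ω) (hY : ∀ ω, 0 ≤ Y ω) (h : ∀ ω, X ω * Y ω = 0) :
    Antimonotonic X Y := by
  intro ω ω'
  simp only [Pi.neg_apply]
  nlinarith [h ω, h ω', mul_nonneg (hX ω) (hY ω'), mul_nonneg (hX ω') (hY ω)]

theorem Antimonotonic.affine {Ω : Type*} {X Y : Ω → ℝ} (h : Antimonotonic X Y)
    (k : ℝ) (t : ℝ) : Antimonotonic ((fun _ => k) + t • X) ((fun _ => k) + t • Y) := by
  intro ω ω'
  have := h ω ω'
  simp only [Pi.neg_apply, Pi.add_apply, Pi.smul_apply, smul_eq_mul] at this ⊢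
  nlinarith [mul_nonneg (sq_nonneg t) this]

/-- The values of a positively homogeneous functional that is additive on antimonotonic pairs,
on nonnegative combinations of the indicators of the fibres of a measurable map. -/
theorem sum_fibre_indicator_of_antimonotonic_additive {Ω ι : Type*} [MeasurableSpace Ω]
    [MeasurableSpace ι] [MeasurableSingletonClass ι] (J : (Ω → ℝ) → ℝ)
    (hsmul : ∀ c : ℝ, 0 ≤ c → ∀ X ∈ BddMeas Ω, J (c • X) = c * J X)
    (hadd : ∀ X ∈ BddMeas Ω, ∀ Y ∈ BddMeas Ω, Antimonotonic X Y → J (X + Y) = J X + J Y)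
    {Z : Ω → ι} (hZ : Measurable Z) {h : ι → ℝ} (hh : ∀ i, 0 ≤ h i) (s : Finset ι) :
    (∑ i ∈ s, h i • (Z ⁻¹' {i}).indicator (1 : Ω → ℝ)) ∈ BddMeas Ω ∧
      J (∑ i ∈ s, h i • (Z ⁻¹' {i}).indicator (1 : Ω → ℝ)) =
        ∑ i ∈ s, h i * J ((Z ⁻¹' {i}).indicator 1) := by
  classical
  have hind : ∀ i, (Z ⁻¹' {i}).indicator (1 : Ω → ℝ) ∈ BddMeas Ω := fun i =>
    BddMeas.indicator_one_s8 (hZ (measurableSet_singleton i))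
  induction s using Finset.induction_on with
  | empty =>
    have h0 := hsmul 0 le_rfl _ (BddMeas.const_s8 0)
    rw [zero_smul, zero_mul] at h0
    exact ⟨by exact BddMeas.const_s8 (Ω := Ω) 0, by simpa using h0⟩
  | insert a s ha ih =>
    rw [Finset.sum_insert ha, Finset.sum_insert ha]
    have hm := BddMeas.smul_mem (h a) (hind a)
    refine ⟨BddMeas.add_mem hm ih.1, ?_⟩
    rw [hadd _ hm _ ih.1, ih.2, hsmul _ (hh a) _ (hind a)]
    refine antimonotonic_of_disjoint_support (fun ω => ?_) (fun ω => ?_) (fun ω => ?_)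
    · exact mul_nonneg (hh a) (Set.indicator_nonneg (fun _ _ => zero_le_one) ω)
    · rw [Finset.sum_apply]
      exact Finset.sum_nonneg fun i _ =>
        mul_nonneg (hh i) (Set.indicator_nonneg (fun _ _ => zero_le_one) ω)
    · rw [Finset.sum_apply, Finset.mul_sum]
      refine Finset.sum_eq_zero fun i hi => ?_
      have hia : i ≠ a := fun e => ha (e ▸ hi)
      by_cases h1 : Z ω = a
      · have : Z ω ≠ i := fun e => hia (e.symm.trans h1)
        simp [this]
      · simp [h1]

theorem sum_fibre_indicator_eq_comp {Ω ι : Type*} {Z : Ω → ι} {s : Finset ι}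
    (hs : ∀ ω, Z ω ∈ s) (h : ι → ℝ) :
    ∑ i ∈ s, h i • (Z ⁻¹' {i}).indicator (1 : Ω → ℝ) = h ∘ Z := by
  classical
  funext ω
  rw [Finset.sum_apply, Finset.sum_eq_single_of_mem (Z ω) (hs ω)]
  · simp
  · intro i _ hi
    simp [hi.symm]

theorem comp_add_of_antimonotonic_additive {Ω ι : Type*} [MeasurableSpace Ω]
    [MeasurableSpace ι] [MeasurableSingletonClass ι] (J : (Ω → ℝ) → ℝ)
    (hsmul : ∀ c : ℝ, 0 ≤ c → ∀ X ∈ BddMeas Ω, J (c • X) = c * J X)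
    (hadd : ∀ X ∈ BddMeas Ω, ∀ Y ∈ BddMeas Ω, Antimonotonic X Y → J (X + Y) = J X + J Y)
    {Z : Ω → ι} (hZ : Measurable Z) {s : Finset ι} (hs : ∀ ω, Z ω ∈ s)
    {g h : ι → ℝ} (hg : ∀ i, 0 ≤ g i) (hh : ∀ i, 0 ≤ h i) :
    g ∘ Z ∈ BddMeas Ω ∧ h ∘ Z ∈ BddMeas Ω ∧
      J (g ∘ Z + h ∘ Z) = J (g ∘ Z) + J (h ∘ Z) := by
  have key : ∀ {f : ι → ℝ}, (∀ i, 0 ≤ f i) → _ := fun {f} hf =>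
    sum_fibre_indicator_of_antimonotonic_additive J hsmul hadd hZ hf s
  have e : g ∘ Z + h ∘ Z = (g + h) ∘ Z := rfl
  obtain ⟨h1, h2⟩ := key hg
  obtain ⟨h3, h4⟩ := key hh
  obtain ⟨-, h6⟩ := key (f := g + h) (fun i => add_nonneg (hg i) (hh i))
  rw [sum_fibre_indicator_eq_comp hs] at h1 h2 h3 h4 h6
  refine ⟨h1, h3, ?_⟩
  rw [e, h2, h4, h6, ← Finset.sum_add_distrib]
  exact Finset.sum_congr rfl fun i _ => add_mul _ _ _

theorem add_of_antimonotonic_additive_of_nonneg {Ω : Type*} [MeasurableSpace Ω]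
    (J : (Ω → ℝ) → ℝ)
    (hsmul : ∀ c : ℝ, 0 ≤ c → ∀ X ∈ BddMeas Ω, J (c • X) = c * J X)
    (hadd : ∀ X ∈ BddMeas Ω, ∀ Y ∈ BddMeas Ω, Antimonotonic X Y → J (X + Y) = J X + J Y)
    (hcont : ∀ X ∈ BddMeas Ω, ∀ ε > (0 : ℝ), ∃ δ > (0 : ℝ), ∀ Y ∈ BddMeas Ω,
      (∀ ω, |X ω - Y ω| ≤ δ) → |J X - J Y| ≤ ε)
    {X Y : Ω → ℝ} (hX : X ∈ BddMeas Ω) (hY : Y ∈ BddMeas Ω)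
    (hX0 : ∀ ω, 0 ≤ X ω) (hY0 : ∀ ω, 0 ≤ Y ω) : J (X + Y) = J X + J Y := by
  have approx : ∀ δ > (0 : ℝ), ∃ X' ∈ BddMeas Ω, ∃ Y' ∈ BddMeas Ω,
      (∀ ω, |X ω - X' ω| ≤ δ) ∧ (∀ ω, |Y ω - Y' ω| ≤ δ) ∧ J (X' + Y') = J X' + J Y' := by
    intro δ hδ
    have floor_close : ∀ x : ℝ, 0 ≤ x → |x - δ * (⌊x / δ⌋₊ : ℝ)| ≤ δ := by
      intro x hx
      have h1 := Nat.floor_le (div_nonneg hx hδ.le)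
      have h2 := (Nat.lt_floor_add_one (x / δ)).le
      rw [le_div_iff₀ hδ] at h1
      rw [div_le_iff₀ hδ] at h2
      rw [abs_le]
      constructor <;> linarith
    obtain ⟨hXm, M, hM⟩ := hX
    obtain ⟨hYm, N, hN⟩ := hY
    have hZ : Measurable fun ω => (⌊X ω / δ⌋₊, ⌊Y ω / δ⌋₊) :=
      (Nat.measurable_floor.comp (hXm.div_const δ)).prodMk
        (Nat.measurable_floor.comp (hYm.div_const δ))
    obtain ⟨h1, h2, h3⟩ := comp_add_of_antimonotonic_additive J hsmul hadd hZ
      (s := Finset.range (⌊M / δ⌋₊ + 1) ×ˢ Finset.range (⌊N / δ⌋₊ + 1))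
      (g := fun i => δ * (i.1 : ℝ)) (h := fun i => δ * (i.2 : ℝ))
      (fun ω => by
        simp only [Finset.mem_product, Finset.mem_range, Nat.lt_add_one_iff]
        exact ⟨Nat.floor_le_floor (div_le_div_of_nonneg_right ((le_abs_self _).trans (hM ω)) hδ.le),
          Nat.floor_le_floor (div_le_div_of_nonneg_right ((le_abs_self _).trans (hN ω)) hδ.le)⟩)
      (fun i => by positivity) (fun i => by positivity)
    exact ⟨_, h1, _, h2, fun ω => floor_close _ (hX0 ω), fun ω => floor_close _ (hY0 ω), h3⟩
  refine eq_of_abs_sub_le_all fun ε hε => ?_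
  obtain ⟨δ₁, hδ₁, h1⟩ := hcont X hX (ε / 3) (by positivity)
  obtain ⟨δ₂, hδ₂, h2⟩ := hcont Y hY (ε / 3) (by positivity)
  obtain ⟨δ₃, hδ₃, h3⟩ := hcont (X + Y) (BddMeas.add_mem hX hY) (ε / 3) (by positivity)
  obtain ⟨X', hX', Y', hY', hXX, hYY, e⟩ :=
    approx (min (min δ₁ δ₂) (δ₃ / 2)) (by positivity)
  have b1 := h1 X' hX' fun ω =>
    (hXX ω).trans ((min_le_left _ _).trans (min_le_left _ _))
  have b2 := h2 Y' hY' fun ω =>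
    (hYY ω).trans ((min_le_left _ _).trans (min_le_right _ _))
  have b3 := h3 (X' + Y') (BddMeas.add_mem hX' hY') fun ω => by
    have c1 := (hXX ω).trans (min_le_right _ _)
    have c2 := (hYY ω).trans (min_le_right _ _)
    simp only [Pi.add_apply]
    rw [abs_le] at *
    constructor <;> linarith [c1.1, c1.2, c2.1, c2.2]
  rw [abs_le] at *
  constructor <;> linarith [b1.1, b1.2, b2.1, b2.2, b3.1, b3.2]

/-- A sup-norm continuous, positively homogeneous functional on bounded measurable functions
that is additive on antimonotonic pairs is additive. -/
theorem add_of_antimonotonic_additive {Ω : Type*} [MeasurableSpace Ω]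
    (J : (Ω → ℝ) → ℝ)
    (hsmul : ∀ c : ℝ, 0 ≤ c → ∀ X ∈ BddMeas Ω, J (c • X) = c * J X)
    (hadd : ∀ X ∈ BddMeas Ω, ∀ Y ∈ BddMeas Ω, Antimonotonic X Y → J (X + Y) = J X + J Y)
    (hcont : ∀ X ∈ BddMeas Ω, ∀ ε > (0 : ℝ), ∃ δ > (0 : ℝ), ∀ Y ∈ BddMeas Ω,
      (∀ ω, |X ω - Y ω| ≤ δ) → |J X - J Y| ≤ ε)
    {X Y : Ω → ℝ} (hX : X ∈ BddMeas Ω) (hY : Y ∈ BddMeas Ω) : J (X + Y) = J X + J Y := by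
  have shift : ∀ W ∈ BddMeas Ω, ∀ c : ℝ, J (W + fun _ => c) = J W + J (fun _ => c) :=
    fun W hW c => hadd W hW _ (BddMeas.const_s8 c) (antimonotonic_const_right W c)
  obtain ⟨M, hM⟩ := hX.2
  obtain ⟨N, hN⟩ := hY.2
  have h := add_of_antimonotonic_additive_of_nonneg J hsmul hadd hcont
    (BddMeas.add_mem hX (BddMeas.const_s8 M)) (BddMeas.add_mem hY (BddMeas.const_s8 N))
    (fun ω => by simpa using neg_le_iff_add_nonneg.1 (abs_le.1 (hM ω)).1)
    (fun ω => by simpa using neg_le_iff_add_nonneg.1 (abs_le.1 (hN ω)).1)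
  have e : (X + fun _ => M) + (Y + fun _ => N) = (X + Y) + ((fun _ => M) + fun _ => N) := by
    abel
  have e' : ((fun _ => M) + fun _ => N : Ω → ℝ) = fun _ => M + N := rfl
  have hc := shift _ (BddMeas.const_s8 M) N
  rw [e, e', shift _ (BddMeas.add_mem hX hY), ← e', hc, shift X hX, shift Y hY] at h
  linarith

/-- On a convex subdomain of the bounded measurable functions containing a
sup-metric ball around a constant function, a sup-metric continuous functional
is antimonotonically affine if and only if it is affine. -/
theorem am_affine_iff_affine_of_continuous {Ω : Type*} [MeasurableSpace Ω]
    (D : Set (Ω → ℝ)) (hDB : D ⊆ BddMeas Ω) (hconv : Convex ℝ D)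
    (hball : ∃ k : ℝ, ∃ ε > (0:ℝ), ∀ Y ∈ BddMeas Ω,
      (∀ ω, |Y ω - k| ≤ ε) → Y ∈ D)
    (I : (Ω → ℝ) → ℝ)
    (hcont : ∀ X ∈ D, ∀ ε > (0:ℝ), ∃ δ > (0:ℝ), ∀ Y ∈ D,
      (∀ ω, |X ω - Y ω| ≤ δ) → |I X - I Y| ≤ ε) :
    (∀ α ∈ Set.Icc (0:ℝ) 1, ∀ X ∈ D, ∀ Y ∈ D, Antimonotonic X Y →
      I (α • X + (1 - α) • Y) = α * I X + (1 - α) * I Y) ↔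
    (∀ α ∈ Set.Icc (0:ℝ) 1, ∀ X ∈ D, ∀ Y ∈ D,
      I (α • X + (1 - α) • Y) = α * I X + (1 - α) * I Y) := by
  refine ⟨fun hI => ?_, fun h α hα X hX Y hY _ => h α hα X hX Y hY⟩
  obtain ⟨k, ε, hε, hball⟩ := hball
  have hkD : (fun _ : Ω => k) ∈ D := hball _ (BddMeas.const_s8 k) fun ω => by simpa using hε.le
  have ray : ∀ α ∈ Set.Icc (0 : ℝ) 1, ∀ X, (fun _ => k) + X ∈ D →
      I ((fun _ => k) + α • X) = α * I ((fun _ => k) + X) + (1 - α) * I (fun _ => k) := by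
    intro α hα X hX
    rw [← hI α hα _ hX _ hkD (antimonotonic_const_right _ k)]
    congr 1
    funext ω
    simp only [Pi.add_apply, Pi.smul_apply, smul_eq_mul]
    ring
  have slope_le : ∀ X : Ω → ℝ, ∀ s t : ℝ, 0 < s → s ≤ t → (fun _ => k) + t • X ∈ D →
      t * (I ((fun _ => k) + s • X) - I (fun _ => k)) =
        s * (I ((fun _ => k) + t • X) - I (fun _ => k)) := by
    intro X s t hs hst ht
    have ht0 : 0 < t := hs.trans_le hst
    have h := ray (s / t) ⟨by positivity, (div_le_one ht0).2 hst⟩ _ ht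
    rw [smul_smul, div_mul_cancel₀ _ ht0.ne'] at h
    rw [h]
    field_simp
    ring
  have exists_slope : ∀ X : Ω → ℝ, ∃ j : ℝ, ∀ t > (0 : ℝ), (fun _ => k) + t • X ∈ D →
      I ((fun _ => k) + t • X) = I (fun _ => k) + t * j := by
    intro X
    by_cases h : ∃ s > (0 : ℝ), (fun _ => k) + s • X ∈ D
    · obtain ⟨s, hs, hsD⟩ := h
      refine ⟨(I ((fun _ => k) + s • X) - I (fun _ => k)) / s, fun t ht htD => ?_⟩
      have : s * (I ((fun _ => k) + t • X) - I (fun _ => k)) =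
          t * (I ((fun _ => k) + s • X) - I (fun _ => k)) := by
        rcases le_total s t with hst | hst
        · exact (slope_le X s t hs hst htD).symm
        · exact slope_le X t s ht hst hsD
      field_simp
      linarith
    · exact ⟨0, fun t ht htD => (h ⟨t, ht, htD⟩).elim⟩
  choose J hJ using exists_slope
  have mem_of_bound : ∀ X ∈ BddMeas Ω, ∀ M t : ℝ, (∀ ω, |X ω| ≤ M) → 0 < t → t * M ≤ ε →
      (fun _ => k) + t • X ∈ D := by
    intro X hX M t hM ht htM
    refine hball _ (BddMeas.add_mem (BddMeas.const_s8 k) (BddMeas.smul_mem t hX)) fun ω => ?_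
    simp only [Pi.add_apply, Pi.smul_apply, smul_eq_mul, add_sub_cancel_left, abs_mul,
      abs_of_pos ht]
    exact (mul_le_mul_of_nonneg_left (hM ω) ht.le).trans htM
  have exists_scale : ∀ M : ℝ, ∃ t > (0 : ℝ), t * M ≤ ε := by
    intro M
    refine ⟨ε / (|M| + 1), by positivity, ?_⟩
    rw [div_mul_eq_mul_div, div_le_iff₀ (by positivity)]
    nlinarith [le_abs_self M]
  have hsmul : ∀ c : ℝ, 0 ≤ c → ∀ X ∈ BddMeas Ω, J (c • X) = c * J X := by
    intro c hc X hX
    rcases hc.eq_or_lt with rfl | hc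
    · have h := hJ (0 • X) 1 one_pos (by simpa using hkD)
      simpa using h
    · obtain ⟨M, hM⟩ := (BddMeas.smul_mem c hX).2
      obtain ⟨t, ht, htM⟩ := exists_scale M
      have hm := mem_of_bound _ (BddMeas.smul_mem c hX) M t hM ht htM
      have h1 := hJ (c • X) t ht hm
      rw [smul_smul] at hm h1
      rw [hJ X (t * c) (mul_pos ht hc) hm] at h1
      exact mul_left_cancel₀ ht.ne' (by linarith)
  have hadd : ∀ X ∈ BddMeas Ω, ∀ Y ∈ BddMeas Ω, Antimonotonic X Y →
      J (X + Y) = J X + J Y := by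
    intro X hX Y hY hXY
    obtain ⟨M, hM⟩ := hX.2
    obtain ⟨N, hN⟩ := hY.2
    obtain ⟨t, ht, htM⟩ := exists_scale (max M N)
    have hXD := mem_of_bound X hX _ t (fun ω => (hM ω).trans (le_max_left _ _)) ht htM
    have hYD := mem_of_bound Y hY _ t (fun ω => (hN ω).trans (le_max_right _ _)) ht htM
    have e : (1 / 2 : ℝ) • ((fun _ => k) + t • X) + (1 - 1 / 2 : ℝ) • ((fun _ => k) + t • Y) =
        (fun _ => k) + (t / 2) • (X + Y) := by
      funext ω
      simp only [Pi.add_apply, Pi.smul_apply, smul_eq_mul]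
      ring
    have hm := hconv hXD hYD (a := 1 / 2) (b := 1 - 1 / 2) (by norm_num) (by norm_num)
      (by norm_num)
    have h := hI (1 / 2) ⟨by norm_num, by norm_num⟩ _ hXD _ hYD (hXY.affine k t)
    rw [e] at hm h
    rw [hJ _ _ (half_pos ht) hm, hJ _ _ ht hXD, hJ _ _ ht hYD] at h
    exact mul_left_cancel₀ ht.ne' (by linarith)
  have hcontJ : ∀ X ∈ BddMeas Ω, ∀ η > (0 : ℝ), ∃ δ > (0 : ℝ), ∀ Y ∈ BddMeas Ω,
      (∀ ω, |X ω - Y ω| ≤ δ) → |J X - J Y| ≤ η := by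
    intro X hX η hη
    obtain ⟨M, hM⟩ := hX.2
    obtain ⟨t, ht, htM⟩ := exists_scale (M + 1)
    have hXD := mem_of_bound X hX _ t (fun ω => (hM ω).trans (by linarith)) ht htM
    obtain ⟨δ, hδ, h⟩ := hcont _ hXD (t * η) (mul_pos ht hη)
    refine ⟨min 1 (δ / t), by positivity, fun Y hY hXY => ?_⟩
    have hYD := mem_of_bound Y hY _ t (fun ω => by
      have h1 := abs_le.1 ((hXY ω).trans (min_le_left _ _))
      have h2 := abs_le.1 (hM ω)
      exact abs_le.2 ⟨by linarith [h1.2, h2.1], by linarith [h1.1, h2.2]⟩) ht htM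
    have hb := h _ hYD fun ω => by
      have h1 := (hXY ω).trans (min_le_right _ _)
      rw [le_div_iff₀ ht] at h1
      simp only [Pi.add_apply, Pi.smul_apply, smul_eq_mul, add_sub_add_left_eq_sub]
      rw [← mul_sub, abs_mul, abs_of_pos ht]
      linarith
    rw [hJ _ _ ht hXD, hJ _ _ ht hYD, add_sub_add_left_eq_sub, ← mul_sub, abs_mul,
      abs_of_pos ht] at hb
    exact le_of_mul_le_mul_left hb ht
  have hIJ : ∀ X ∈ D, I X = I (fun _ => k) + J (X + fun _ => -k) := by
    intro X hX
    have e : (fun _ => k) + (1 : ℝ) • (X + fun _ => -k) = X := by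
      funext ω
      simp
    have h := hJ (X + fun _ => -k) 1 one_pos (by rwa [e])
    rwa [e, one_mul] at h
  intro α hα X hX Y hY
  have hX' := BddMeas.add_mem (hDB hX) (BddMeas.const_s8 (-k))
  have hY' := BddMeas.add_mem (hDB hY) (BddMeas.const_s8 (-k))
  have hα' : 0 ≤ 1 - α := sub_nonneg.2 hα.2
  have e : (α • X + (1 - α) • Y) + (fun _ => -k) =
      α • (X + fun _ => -k) + (1 - α) • (Y + fun _ => -k) := by
    funext ω
    simp only [Pi.add_apply, Pi.smul_apply, smul_eq_mul]
    ring
  rw [hIJ _ (hconv hX hY hα.1 hα' (by ring)), hIJ X hX, hIJ Y hY, e,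
    add_of_antimonotonic_additive J hsmul hadd hcontJ (BddMeas.smul_mem α hX') (BddMeas.smul_mem (1 - α) hY'),
    hsmul α hα.1 _ hX', hsmul _ hα' _ hY']
  ring
end
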